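/- arXiv:2008.05821 — 6 statements merged into one kernel-verified Lean document; each statement's English description precedes it below -/
import Mathlib

section
/- For every cardinal κ, setting λ = max{ℵ₀, (2^κ)^+}, the relation λ → (λ)_κ^AFP holds: for every group G with |G| = λ and every colouring c : G → κ there exists an injective λ-sequence (g_α)_{α<λ} of elements of G such that AFP(g_α | α<λ) is monochromatic for c. -/
universe u

open Cardinal

/-- The product `g α * g (α+1) * ⋯ * g (α+n)` of adjacent terms of the sequence `g`. -/
def adjProd {G : Type u} [Group G] (g : Ordinal.{u} → G) (α : Ordinal.{u}) : ℕ → G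
  | 0 => g α
  | n + 1 => adjProd g α n * g (α + ((n : Ordinal) + 1))

/-- The set of adjacent finite products of the `μ`-sequence `g`:
`AFP(g_α | α < μ) = { g_α · g_{α+1} ⋯ g_{α+n} : α < μ, n < ω, α + n < μ }`. -/
def AFP {G : Type u} [Group G] (μ : Ordinal.{u}) (g : Ordinal.{u} → G) : Set G :=
  { x | ∃ α < μ, ∃ n : ℕ, α + (n : Ordinal) < μ ∧ x = adjProd g α n }

/-- `G → (μ)_κ^AFP`: for every colouring `c : G → κ` there is an injective `μ`-sequence
of elements of `G` whose set of adjacent finite products is monochromatic for `c`. -/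
def ArrowAFP (G : Type u) [Group G] (μ : Ordinal.{u}) (κ : Cardinal.{u}) : Prop :=
  ∀ c : G → κ.out, ∃ g : Ordinal.{u} → G,
    (∀ α < μ, ∀ β < μ, g α = g β → α = β) ∧
    ∃ i : κ.out, ∀ x ∈ AFP μ g, c x = i

section Homogeneous

variable {X K : Type u}

/-- An end-homogeneity criterion: if `φ` predicts the colours `f a q` for suitable `q ∈ M`,
simultaneously for all `a` in a family of finite sets indexed by the colours, then `f` has an
infinite homogeneous sequence. -/
theorem exists_homogeneous_seq_of_reflection (f : X → X → K) (M : Set X) (φ : X → K)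
    (H : ∀ s : K → Finset X, (∀ i, ∀ a ∈ s i, a ∈ M) →
      ∃ q ∈ M, ∀ i, ∀ a ∈ s i, a ≠ q ∧ f a q = φ a) :
    ∃ (i : K) (h : ℕ → X), ∀ m n, m < n → h m ≠ h n ∧ f (h m) (h n) = i := by
  by_contra hcon
  have key : ∀ i : K, ∃ s : Finset X, (∀ x ∈ s, x ∈ M ∧ φ x = i) ∧
      ∀ y, (y ∈ M ∧ φ y = i) → ¬ ∀ x ∈ s, x ≠ y ∧ f x y = i := by
    intro i
    by_contra hi
    push Not at hi
    obtain ⟨h, -, hr⟩ := exists_seq_of_forall_finset_exists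
      (fun x => x ∈ M ∧ φ x = i) (fun x y => x ≠ y ∧ f x y = i) hi
    exact hcon ⟨i, h, hr⟩
  choose s hs hmax using key
  obtain ⟨q, hqM, hq⟩ := H s fun i a ha => (hs i a ha).1
  exact hmax (φ q) q ⟨hqM, rfl⟩ fun x hx =>
    ⟨(hq _ x hx).1, (hq _ x hx).2.trans (hs _ x hx).2⟩

/-- Infinite Ramsey theorem for pairs, with finitely many colours. -/
theorem exists_homogeneous_seq_of_finite [Infinite X] [Finite K] (f : X → X → K) :
    ∃ (i : K) (h : ℕ → X), ∀ m n, m < n → h m ≠ h n ∧ f (h m) (h n) = i := by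
  have lim : ∀ a, ∃ i, ∀ᶠ q in Filter.hyperfilter X, f a q = i := by
    intro a
    have h := (Ultrafilter.finite_biUnion_mem_iff (f := Filter.hyperfilter X)
      (s := fun i => {q | f a q = i}) (Set.finite_univ (α := K))).1
      (Filter.mem_of_superset Filter.univ_mem fun q _ => by simp)
    obtain ⟨i, -, hi⟩ := h
    exact ⟨i, hi⟩
  choose φ hφ using lim
  refine exists_homogeneous_seq_of_reflection f Set.univ φ fun s _ => ?_
  have hev : ∀ᶠ q in (Filter.hyperfilter X : Filter X),
      ∀ i, ∀ a ∈ s i, a ≠ q ∧ f a q = φ a := by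
    rw [Filter.eventually_all]
    intro i
    rw [Filter.eventually_all_finset]
    intro a _
    refine Filter.Eventually.and ?_ (hφ a)
    have := Set.Finite.compl_mem_hyperfilter (Set.finite_singleton a)
    filter_upwards [this] with q hq
    exact fun h => hq h.symm
  obtain ⟨q, hq⟩ := hev.exists
  exact ⟨q, trivial, hq⟩

/-- In a type with more than `2 ^ #K` elements there are a subset `M` and a point `p ∉ M` whose
`f`-type over any subset of `M` of size at most `#K` is realised in `M`. -/
theorem exists_reflecting_set [Infinite K] (f : X → X → K) (hX : 2 ^ #K < #X) :
    ∃ (M : Set X) (p : X), p ∉ M ∧ ∀ A ⊆ M, #A ≤ #K →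
      ∃ q ∈ M, ∀ a ∈ A, a ≠ q ∧ f a q = f a p := by
  have hK : ℵ₀ ≤ #K := aleph0_le_mk K
  obtain ⟨x₀⟩ : Nonempty X := mk_ne_zero_iff.1 (ne_bot_of_gt hX)
  let W := WType fun t : Set K × (K → K) => (t.1 : Type u)
  have choice : ∀ (t : Set K × (K → K)) (u : t.1 → X), ∃ q, (∃ q', ∀ j, u j ≠ q' ∧
      f (u j) q' = t.2 j) → ∀ j, u j ≠ q ∧ f (u j) q = t.2 j := by
    intro t u
    by_cases h : ∃ q', ∀ j, u j ≠ q' ∧ f (u j) q' = t.2 j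
    · exact h.imp fun _ hq _ => hq
    · exact ⟨x₀, fun h' => (h h').elim⟩
  choose F hF using choice
  let ev : W → X := WType.elim X fun z => F z.1 z.2
  have hW : #W ≤ 2 ^ #K := by
    refine WType.cardinalMk_le_of_le ?_
    calc (sum fun t : Set K × (K → K) => ((2 : Cardinal) ^ #K) ^ #(t.1 : Type u))
        ≤ sum fun _ : Set K × (K → K) => (2 : Cardinal) ^ #K := by
          refine sum_le_sum _ _ fun t => ?_
          rw [← power_mul]
          exact power_le_power_left two_ne_zero
            ((mul_le_mul_right (mk_set_le t.1) _).trans (mul_eq_self hK).le)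
      _ = 2 ^ #K := by
          have h2 : ℵ₀ ≤ (2 : Cardinal) ^ #K := hK.trans (cantor _).le
          simp [power_self_eq hK, mul_eq_self h2]
  have hne : ∃ p, p ∉ Set.range ev := by
    by_contra! h
    exact (mk_range_le.trans hW).not_gt
      (by rwa [Set.eq_univ_of_forall h, mk_univ])
  obtain ⟨p, hp⟩ := hne
  refine ⟨Set.range ev, p, hp, fun A hA hAK => ?_⟩
  obtain ⟨e⟩ : Nonempty (A ↪ K) := hAK
  have hsurj : ∀ a : A, ∃ w, ev w = a := fun a => hA a.2
  choose w hw using hsurj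
  let e' : A ≃ Set.range e := Equiv.ofInjective e e.injective
  obtain ⟨v, hv⟩ : ∃ v : K → K, ∀ a : A, v (e a) = f a p :=
    ⟨Function.extend e (fun a => f a p) id, fun a => e.injective.extend_apply _ _ a⟩
  let t : Set K × (K → K) := (Set.range e, v)
  have hsat : ∀ j : t.1, ev (w (e'.symm j)) ≠ p ∧ f (ev (w (e'.symm j))) p = t.2 j := by
    intro j
    obtain ⟨a, rfl⟩ := e'.surjective j
    refine ⟨fun h => hp ⟨_, h⟩, ?_⟩
    rw [e'.symm_apply_apply, hw]
    exact (hv a).symm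
  have hq := hF t (fun j => ev (w (e'.symm j))) ⟨p, hsat⟩
  refine ⟨F t fun j => ev (w (e'.symm j)), ⟨WType.mk t fun j => w (e'.symm j), rfl⟩,
    fun a ha => ?_⟩
  have := hq (e' ⟨a, ha⟩)
  rw [e'.symm_apply_apply, hw] at this
  exact ⟨this.1, this.2.trans (hv ⟨a, ha⟩)⟩

/-- The Erdős–Rado theorem for pairs, for homogeneous sequences of length `ω`. -/
theorem exists_homogeneous_seq_of_two_pow_lt [Infinite K] (f : X → X → K) (hX : 2 ^ #K < #X) :
    ∃ (i : K) (h : ℕ → X), ∀ m n, m < n → h m ≠ h n ∧ f (h m) (h n) = i := by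
  obtain ⟨M, p, -, hM⟩ := exists_reflecting_set f hX
  refine exists_homogeneous_seq_of_reflection f M (f · p) fun s hs => ?_
  obtain ⟨q, hqM, hq⟩ := hM (⋃ i, (s i : Set X)) (Set.iUnion_subset hs) (by
    refine (mk_iUnion_le _).trans (mul_le_of_le (aleph0_le_mk K) le_rfl (ciSup_le' fun i => ?_))
    exact (lt_aleph0_of_finite _).le.trans (aleph0_le_mk K))
  exact ⟨q, hqM, fun i a ha => hq a (Set.mem_iUnion.2 ⟨i, ha⟩)⟩

end Homogeneous

section Blocks

variable {G : Type u} [Group G]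

/-- The quotients of consecutive terms of a sequence in a group. -/
def stepSeq (h : ℕ → G) (n : ℕ) : G := (h n)⁻¹ * h (n + 1)

/-- Every injective sequence has a subsequence with injective consecutive quotients. -/
theorem exists_strictMono_stepSeq_injective (h : ℕ → G) (hh : Function.Injective h) :
    ∃ k : ℕ → ℕ, StrictMono k ∧ Function.Injective (stepSeq (h ∘ k)) := by
  let S : ℕ → Set G := fun N =>
    (fun t : ℕ × ℕ × ℕ => h t.1 * ((h t.2.1)⁻¹ * h t.2.2)) ''
      (Set.Iic N ×ˢ (Set.Iic N ×ˢ Set.Iic N))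
  have hS : ∀ N, (S N).Finite := fun N =>
    ((Set.finite_Iic N).prod ((Set.finite_Iic N).prod (Set.finite_Iic N))).image _
  obtain ⟨k, -, hk⟩ := exists_seq_of_forall_finset_exists (fun _ : ℕ => True)
    (fun m n => m < n ∧ h n ∉ S m) (by
      intro s _
      have hfin : (⋃ m ∈ s, (Set.Iic m ∪ h ⁻¹' S m)).Finite :=
        s.finite_toSet.biUnion fun m _ =>
          (Set.finite_Iic m).union ((hS m).preimage hh.injOn)
      obtain ⟨n, hn⟩ := hfin.infinite_compl.nonempty
      refine ⟨n, trivial, fun m hm => ?_⟩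
      simp only [Set.mem_compl_iff, Set.mem_iUnion, not_exists] at hn
      have := hn m hm
      simp only [Set.mem_union, Set.mem_Iic, Set.mem_preimage, not_or, not_le] at this
      exact this)
  have hmono : StrictMono k := fun m n hmn => (hk m n hmn).1
  refine ⟨k, hmono, ?_⟩
  refine Function.Injective.of_lt_imp_ne fun m n hmn heq => ?_
  refine (hk n (n + 1) n.lt_succ_self).2 ⟨(k n, k m, k (m + 1)), ?_, ?_⟩
  · exact ⟨le_refl (k n), hmono.monotone hmn.le, hmono.monotone hmn⟩
  · have : (h (k m))⁻¹ * h (k (m + 1)) = (h (k n))⁻¹ * h (k (n + 1)) := heq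
    simp [this]

/-- A sequence whose consecutive quotients are distinct and all of whose forward quotients have
colour `i`. -/
def IsBlock {K : Type*} (c : G → K) (i : K) (h : ℕ → G) : Prop :=
  Function.Injective (stepSeq h) ∧ ∀ m n, m < n → c ((h m)⁻¹ * h n) = i

/-- If pairs in `G ⧸ B` have infinite homogeneous sequences, there is a block avoiding `B`. -/
theorem exists_isBlock_of_homogeneous {K : Type*} (c : G → K) (B : Subgroup G)
    (H : ∀ f : G ⧸ B → G ⧸ B → K, ∃ (i : K) (h : ℕ → G ⧸ B),
      ∀ m n, m < n → h m ≠ h n ∧ f (h m) (h n) = i) :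
    ∃ (i : K) (h : ℕ → G), IsBlock c i h ∧ ∀ n, stepSeq h n ∉ B := by
  obtain ⟨i, h, hh⟩ := H fun x y => c (x.out⁻¹ * y.out)
  have hinj : Function.Injective fun n => (h n).out := fun m n hmn =>
    (Function.Injective.of_lt_imp_ne fun m n hmn => (hh m n hmn).1) (Quotient.out_injective hmn)
  obtain ⟨k, hk, hki⟩ := exists_strictMono_stepSeq_injective _ hinj
  refine ⟨i, _, ⟨hki, fun m n hmn => (hh _ _ (hk hmn)).2⟩, fun n hn => ?_⟩
  refine (hh _ _ (hk n.lt_succ_self)).1 ?_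
  have := QuotientGroup.eq.2 hn
  simpa using this

open Ordinal in
/-- Blocks with pairwise disjoint sets of consecutive quotients concatenate to a sequence with
monochromatic adjacent finite products. -/
theorem exists_monochromatic_AFP_of_blocks {K : Type*} (c : G → K) (i : K) (μ : Ordinal.{u})
    (h : Ordinal.{u} → ℕ → G) (hb : ∀ ξ, IsBlock c i (h ξ))
    (hdisj : ∀ α < μ, ∀ β < μ, ∀ m n,
      stepSeq (h (α / ω)) m = stepSeq (h (β / ω)) n → α / ω = β / ω) :
    ∃ g : Ordinal.{u} → G, (∀ α < μ, ∀ β < μ, g α = g β → α = β) ∧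
      ∀ x ∈ AFP μ g, c x = i := by
  let g : Ordinal.{u} → G := fun α => stepSeq (h (α / ω)) (Cardinal.toNat (α % ω).card)
  have hmod : ∀ α : Ordinal.{u}, ∃ n : ℕ, α % ω = n := fun α =>
    lt_omega0.1 (mod_lt α omega0_ne_zero)
  have hg : ∀ α : Ordinal.{u}, ∀ n k : ℕ, α % ω = n →
      g (α + k) = stepSeq (h (α / ω)) (n + k) := by
    intro α n k hn
    have hα : α + k = ω * (α / ω) + ((n + k : ℕ) : Ordinal) := by
      conv_lhs => rw [← div_add_mod α ω, hn]
      rw [Nat.cast_add, add_assoc]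
    have hdiv : (α + k) / ω = α / ω := by
      rw [hα, mul_add_div _ omega0_ne_zero, div_eq_zero_of_lt (natCast_lt_omega0 _), add_zero]
    have hm : (α + k) % ω = ((n + k : ℕ) : Ordinal) := by
      rw [hα, mul_add_mod_self, natCast_mod_omega0]
    simp only [g, hdiv, hm, card_nat, toNat_natCast]
  have hprod : ∀ α : Ordinal.{u}, ∀ n k : ℕ, α % ω = n →
      adjProd g α k = (h (α / ω) n)⁻¹ * h (α / ω) (n + k + 1) := by
    intro α n k hn
    induction k with
    | zero => simpa [adjProd, stepSeq] using hg α n 0 hn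
    | succ k ih =>
      have := hg α n (k + 1) hn
      rw [Nat.cast_succ] at this
      rw [adjProd, ih, this, stepSeq]
      simp [mul_assoc, add_assoc]
  refine ⟨g, fun α hα β hβ hαβ => ?_, ?_⟩
  · obtain ⟨m, hm⟩ := hmod α
    obtain ⟨n, hn⟩ := hmod β
    have e1 := hg α m 0 hm
    have e2 := hg β n 0 hn
    simp only [Nat.cast_zero, add_zero] at e1 e2
    rw [e1, e2] at hαβ
    have hdiv := hdisj α hα β hβ _ _ hαβ
    rw [hdiv] at hαβ
    rw [← div_add_mod α ω, ← div_add_mod β ω, hm, hn, hdiv, (hb _).1 hαβ]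
  · rintro x ⟨α, -, k, -, rfl⟩
    obtain ⟨n, hn⟩ := hmod α
    rw [hprod α n k hn]
    exact (hb _).2 _ _ (by omega)

theorem mk_subgroup_closure_le (s : Set G) : #(Subgroup.closure s) ≤ max #s ℵ₀ := by
  have h : Subgroup.closure s = (FreeGroup.lift (Subtype.val : s → G)).range := by
    rw [FreeGroup.range_lift_eq_closure, Subtype.range_coe]
  rw [h, ← SetLike.coe_sort_coe, MonoidHom.coe_range]
  refine mk_range_le.trans ?_
  rcases isEmpty_or_nonempty s with hs | hs
  · exact mk_le_aleph0.trans (le_max_right _ _)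
  · exact (mk_freeGroup s).le

theorem mk_quotient_eq_of_mk_lt (B : Subgroup G) (hG : ℵ₀ ≤ #G) (hB : #B < #G) :
    #(G ⧸ B) = #G := by
  have h : #G = #(G ⧸ B) * #B := by
    rw [mul_def]
    exact mk_congr Subgroup.groupEquivQuotientProdSubgroup
  refine le_antisymm (mk_le_of_surjective QuotientGroup.mk_surjective) (le_of_not_gt fun hlt => ?_)
  exact (mul_lt_of_lt hG hlt hB).ne' h

/-- If blocks avoiding any given small subgroup exist, there are `#G` many blocks whose sets of
consecutive quotients are pairwise disjoint. -/
theorem exists_disjoint_blocks {K : Type*} (c : G → K) (hG : ℵ₀ < #G)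
    (H : ∀ B : Subgroup G, #B < #G →
      ∃ (i : K) (h : ℕ → G), IsBlock c i h ∧ ∀ n, stepSeq h n ∉ B) :
    ∃ 𝓕 : Set (ℕ → G), #G ≤ #𝓕 ∧ (∀ h ∈ 𝓕, ∃ i, IsBlock c i h) ∧
      ∀ h ∈ 𝓕, ∀ h' ∈ 𝓕, ∀ m n, stepSeq h m = stepSeq h' n → h = h' := by
  obtain ⟨𝓕, hmax⟩ := zorn_subset
    {𝓕 : Set (ℕ → G) | (∀ h ∈ 𝓕, ∃ i, IsBlock c i h) ∧
      ∀ h ∈ 𝓕, ∀ h' ∈ 𝓕, ∀ m n, stepSeq h m = stepSeq h' n → h = h'} (by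
    intro C hC hchain
    refine ⟨⋃₀ C, ⟨?_, ?_⟩, fun s hs => Set.subset_sUnion_of_mem hs⟩
    · rintro h ⟨s, hs, hh⟩
      exact (hC hs).1 h hh
    · rintro h ⟨s, hs, hh⟩ h' ⟨s', hs', hh'⟩
      rcases hchain.total hs hs' with hss | hss
      · exact (hC hs').2 h (hss hh) h' hh'
      · exact (hC hs).2 h hh h' (hss hh'))
  refine ⟨𝓕, le_of_not_gt fun hlt => ?_, hmax.prop.1, hmax.prop.2⟩
  let S : Set G := ⋃ h : 𝓕, Set.range (stepSeq h.1)
  have hS : #S < #G := by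
    have hrange : ∀ h : 𝓕, #(Set.range (stepSeq h.1)) ≤ ℵ₀ := fun h =>
      le_aleph0_iff_set_countable.2 (Set.countable_range _)
    exact (mk_iUnion_le _).trans_lt (mul_lt_of_lt hG.le hlt ((ciSup_le' hrange).trans_lt hG))
  obtain ⟨i, h, hb, hav⟩ := H (Subgroup.closure S)
    ((mk_subgroup_closure_le S).trans_lt (max_lt hS hG))
  have hmem : ∀ h' ∈ 𝓕, ∀ n, stepSeq h' n ∈ Subgroup.closure S := fun h' hh' n =>
    Subgroup.subset_closure (Set.mem_iUnion.2 ⟨⟨h', hh'⟩, n, rfl⟩)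
  have hins : insert h 𝓕 ∈ {𝓕 : Set (ℕ → G) | (∀ h ∈ 𝓕, ∃ i, IsBlock c i h) ∧
      ∀ h ∈ 𝓕, ∀ h' ∈ 𝓕, ∀ m n, stepSeq h m = stepSeq h' n → h = h'} := by
    refine ⟨?_, ?_⟩
    · rintro h' (rfl | hh')
      · exact ⟨i, hb⟩
      · exact hmax.prop.1 h' hh'
    · rintro h₁ (rfl | hh₁) h₂ (rfl | hh₂) m n hmn
      · rfl
      · exact (hav m (hmn ▸ hmem h₂ hh₂ n)).elim
      · exact (hav n (hmn ▸ hmem h₁ hh₁ m)).elim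
      · exact hmax.prop.2 h₁ hh₁ h₂ hh₂ m n hmn
  have hh : h ∈ 𝓕 := hmax.le_of_ge hins (Set.subset_insert h 𝓕) (Set.mem_insert h 𝓕)
  exact hav 0 (hmem h hh 0)

end Blocks

theorem arrowAFP_omega0_of_finite {κ : Cardinal.{u}} (hκ : κ < ℵ₀) (G : Type u) [Group G]
    [Infinite G] : ArrowAFP G Ordinal.omega0 κ := by
  intro c
  have : Finite κ.out := by rwa [← lt_aleph0_iff_finite, mk_out]
  have : Infinite (G ⧸ (⊥ : Subgroup G)) :=
    QuotientGroup.quotientBot.toEquiv.infinite_iff.2 inferInstance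
  obtain ⟨i, h, hb, -⟩ := exists_isBlock_of_homogeneous c ⊥ exists_homogeneous_seq_of_finite
  obtain ⟨g, hg, hc⟩ := exists_monochromatic_AFP_of_blocks c i Ordinal.omega0 (fun _ => h)
    (fun _ => hb) fun α hα β hβ _ _ _ => by
      rw [Ordinal.div_eq_zero_of_lt hα, Ordinal.div_eq_zero_of_lt hβ]
  exact ⟨g, hg, i, hc⟩

theorem arrowAFP_succ_two_pow_of_infinite {κ : Cardinal.{u}} (hκ : ℵ₀ ≤ κ) (G : Type u) [Group G]
    (hG : #G = Order.succ (2 ^ κ)) :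
    ArrowAFP G (Order.succ ((2 : Cardinal) ^ κ)).ord κ := by
  intro c
  have h2 : ℵ₀ ≤ (2 : Cardinal) ^ κ := hκ.trans (cantor κ).le
  have hlt : (2 : Cardinal) ^ κ < #G := hG ▸ Order.lt_succ _
  have hinf : Infinite κ.out := by rwa [infinite_iff, mk_out]
  obtain ⟨𝓕, hcard, hblock, hdisj⟩ := exists_disjoint_blocks c (h2.trans_lt hlt) fun B hB =>
    exists_isBlock_of_homogeneous c B fun f => exists_homogeneous_seq_of_two_pow_lt f (by
      rwa [mk_out, mk_quotient_eq_of_mk_lt B (h2.trans hlt.le) hB])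
  choose col hcol using fun h : 𝓕 => hblock h.1 h.2
  obtain ⟨i, hi⟩ := infinite_pigeonhole_card col (Order.succ (2 ^ κ)) (hG ▸ hcard)
    (h2.trans (Order.le_succ _)) (by
      rw [(isRegular_succ h2).cof_ord, mk_out]
      exact (cantor κ).trans (Order.lt_succ _))
  rw [← mk_ord_toType (Order.succ (2 ^ κ))] at hi
  obtain ⟨e⟩ := hi
  set μ := (Order.succ ((2 : Cardinal) ^ κ)).ord
  have hpos : 0 < μ := by
    rw [← ord_zero, ord_lt_ord]
    exact (aleph0_pos.trans_le h2).trans (Order.lt_succ _)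
  have hdiv : ∀ α < μ, α / Ordinal.omega0 < μ := fun α hα =>
    ((Ordinal.le_mul_right _ Ordinal.omega0_pos).trans (Ordinal.mul_div_le α _)).trans_lt hα
  let h : Ordinal.{u} → ℕ → G := fun ξ =>
    (e (Ordinal.ToType.mk (if hξ : ξ < μ then ⟨ξ, hξ⟩ else ⟨0, hpos⟩))).1.1
  obtain ⟨g, hg, hc⟩ := exists_monochromatic_AFP_of_blocks c i μ h
    (fun ξ => by
      have := (e (Ordinal.ToType.mk (if hξ : ξ < μ then ⟨ξ, hξ⟩ else ⟨0, hpos⟩))).2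
      rw [← show _ = i from this]
      exact hcol _)
    fun α hα β hβ m n hmn => by
      have heq := hdisj _ (Subtype.prop _) _ (Subtype.prop _) m n hmn
      have := Ordinal.ToType.mk.injective (e.injective (Subtype.ext (Subtype.ext heq)))
      rw [dif_pos (hdiv α hα), dif_pos (hdiv β hβ)] at this
      exact congrArg Subtype.val this
  exact ⟨g, hg, i, hc⟩

/-- For every cardinal `κ`, taking `λ = max(ℵ₀, (2^κ)⁺)` we have `λ → (λ)_κ^AFP`. -/
theorem max_aleph0_succ_two_pow_arrow_AFP (κ : Cardinal.{u}) (G : Type u) [Group G]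
    (hG : #G = max ℵ₀ (Order.succ (2 ^ κ))) :
    ArrowAFP G (max ℵ₀ (Order.succ (2 ^ κ))).ord κ := by
  rcases lt_or_ge κ ℵ₀ with hκ | hκ
  · have hle : Order.succ ((2 : Cardinal) ^ κ) ≤ ℵ₀ :=
      Order.succ_le_of_lt (power_lt_aleph0 natCast_lt_aleph0 hκ)
    rw [max_eq_left hle] at hG ⊢
    have : Infinite G := infinite_iff.2 hG.ge
    rw [ord_aleph0]
    exact arrowAFP_omega0_of_finite hκ G
  · have hle : ℵ₀ ≤ Order.succ ((2 : Cardinal) ^ κ) :=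
      (hκ.trans (cantor κ).le).trans (Order.le_succ _)
    rw [max_eq_right hle] at hG ⊢
    exact arrowAFP_succ_two_pow_of_infinite hκ G hG
end

section
/- Let κ be an infinite cardinal and let G be a group of cardinality (2^κ)^+. Then for every colouring c : G → κ there exists an injective sequence (x_n)_{n<ω} of elements of G such that all adjacent finite products x_n · x_{n+1} ⋯ x_{n+m} (for n, m < ω) receive the same colour; that is, (2^κ)^+ → (ω)_κ^AFP. -/
universe u

open Cardinal

open Pointwise in
/-- From an infinite supply of one-point extensions we extract a sequence whose quotients
`(h m)⁻¹ * h n`, `m < n`, all lie in `Q`, and whose consecutive quotients are distinct. -/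
theorem exists_seq_quotients_mem {G : Type*} [Group G] (P Q : Set G)
    (hPQ : ∀ B : Finset G, ↑B ⊆ P → {a ∈ P | ∀ b ∈ B, b⁻¹ * a ∈ Q}.Infinite) :
    ∃ h : ℕ → G, (∀ m n, m < n → (h m)⁻¹ * h n ∈ Q) ∧
      Function.Injective fun n => (h n)⁻¹ * h (n + 1) := by
  classical
  obtain ⟨f, hf, hr⟩ := exists_seq_of_forall_finset_exists
    (fun p : Finset G × G => ↑p.1 ⊆ P ∧ p.2 ∈ P ∧ (∀ b ∈ p.1, b⁻¹ * p.2 ∈ Q) ∧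
      p.2 ∉ p.1 * p.1⁻¹ * p.1)
    (fun p q => p.2 ∈ q.1) (by
      intro s hs
      have hS : ((s.image Prod.snd : Finset G) : Set G) ⊆ P := by
        intro a ha
        obtain ⟨p, hp, rfl⟩ := Finset.mem_image.1 (Finset.mem_coe.1 ha)
        exact (hs p hp).2.1
      obtain ⟨a, ⟨haP, haQ⟩, ha⟩ := (hPQ _ hS).exists_notMem_finset
        (s.image Prod.snd * (s.image Prod.snd)⁻¹ * s.image Prod.snd)
      exact ⟨(s.image Prod.snd, a), ⟨hS, haP, haQ, ha⟩,
        fun p hp => Finset.mem_image_of_mem _ hp⟩)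
  refine ⟨fun n => (f n).2, fun m n hmn => (hf n).2.2.1 _ (hr m n hmn), ?_⟩
  have key : ∀ m n, m < n → ((f m).2)⁻¹ * (f (m + 1)).2 ≠ ((f n).2)⁻¹ * (f (n + 1)).2 := by
    intro m n hmn heq
    apply (hf (n + 1)).2.2.2
    rw [← mul_inv_cancel_left (f n).2 (f (n + 1)).2, ← heq, ← mul_assoc]
    exact Finset.mul_mem_mul (Finset.mul_mem_mul (hr _ _ (by omega))
      (Finset.inv_mem_inv (hr _ _ (by omega)))) (hr _ _ (by omega))
  intro m n hmn
  by_contra hne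
  rcases lt_or_gt_of_ne hne with h | h
  · exact key m n h hmn
  · exact key n m h hmn.symm

/-- The closure of a point under `2 ^ κ` many operations of arity `κ` has at most `2 ^ κ`
elements. -/
theorem exists_closed_set_mk_le {G ι K : Type u} (hι : ℵ₀ ≤ #ι) (hK : #K ≤ 2 ^ #ι)
    (F : K → (ι → G) → G) (g₀ : G) :
    ∃ A : Set G, #A ≤ 2 ^ #ι ∧ g₀ ∈ A ∧ ∀ k b, (∀ j, b j ∈ A) → F k b ∈ A := by
  let β : Option K → Type u := fun o => o.elim PEmpty fun _ => ι
  let e : WType β → G := fun w => w.elim G fun p =>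
    match p with
    | ⟨none, _⟩ => g₀
    | ⟨some k, t⟩ => F k t
  have hω : ℵ₀ ≤ (2 : Cardinal.{u}) ^ #ι := hι.trans (cantor _).le
  refine ⟨Set.range e, mk_range_le.trans (WType.cardinalMk_le_of_le' ?_), ?_, ?_⟩
  · have hsummand : ∀ o, ((2 : Cardinal.{u}) ^ #ι) ^ #(β o) ≤ 2 ^ #ι := by
      rintro (_ | k)
      · have : #(β none) = 0 := mk_pempty
        rw [this, power_zero]
        exact one_le_aleph0.trans hω
      · change (2 ^ #ι) ^ #ι ≤ _
        rw [← power_mul, mul_eq_self hι]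
    simp only [lift_id]
    calc _ ≤ Cardinal.sum fun _ : Option K => (2 : Cardinal.{u}) ^ #ι := sum_le_sum _ _ hsummand
      _ = #(Option K) * 2 ^ #ι := by simp
      _ ≤ 2 ^ #ι * 2 ^ #ι := by
        gcongr
        rw [mk_option]
        exact add_le_of_le hω hK (one_le_aleph0.trans hω)
      _ = 2 ^ #ι := mul_eq_self hω
  · exact ⟨WType.mk none PEmpty.elim, rfl⟩
  · intro k b hb
    choose t ht using hb
    refine ⟨WType.mk (some k) t, ?_⟩
    change F k (fun j => e (t j)) = _
    simp only [ht]

/-- A `κ`-coloured group with more than `2 ^ κ` elements contains a set in which every finite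
subset has infinitely many one-point extensions with quotients of a fixed colour. -/
theorem exists_infinite_extensions {G ι : Type u} [Group G] (hι : ℵ₀ ≤ #ι)
    (hG : 2 ^ #ι < #G) (c : G → ι) :
    ∃ (P : Set G) (i : ι), ∀ B : Finset G, ↑B ⊆ P →
      {a ∈ P | ∀ b ∈ B, b⁻¹ * a ∈ c ⁻¹' {i}}.Infinite := by
  classical
  let R : (ι → ι) → (ι → G) → G → Prop := fun k b a => a ∉ Set.range b ∧ ∀ j, c ((b j)⁻¹ * a) = k j
  let F : (ι → ι) → (ι → G) → G := fun k b => if h : ∃ a, R k b a then h.choose else 1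
  obtain ⟨A, hA, h1, hF⟩ := exists_closed_set_mk_le hι
    (by rw [← power_def, power_self_eq hι]) F 1
  obtain ⟨x, hx⟩ : ∃ x, x ∉ A := by
    by_contra! h
    rw [Set.eq_univ_of_forall h, mk_univ] at hA
    exact hA.not_gt hG
  suffices ∃ i, ∀ B : Finset G, ↑B ⊆ {a ∈ A | c (a⁻¹ * x) = i} →
      ∃ a ∈ {a ∈ A | c (a⁻¹ * x) = i}, a ∉ B ∧ ∀ b ∈ B, c (b⁻¹ * a) = i by
    obtain ⟨i, hi⟩ := this
    refine ⟨{a ∈ A | c (a⁻¹ * x) = i}, i, fun B hB hfin => ?_⟩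
    obtain ⟨a, haP, haB, ha⟩ := hi (B ∪ hfin.toFinset) (by
      intro a ha
      rcases Finset.mem_union.1 (Finset.mem_coe.1 ha) with h | h
      · exact hB h
      · exact (hfin.mem_toFinset.1 h).1)
    exact haB (Finset.mem_union_right _ (hfin.mem_toFinset.2
      ⟨haP, fun b hb => ha b (Finset.mem_union_left _ hb)⟩))
  by_contra! hcon
  choose B hBP hB using hcon
  let S : Set G := insert 1 (⋃ i, ↑(B i))
  have hSA : S ⊆ A := Set.insert_subset h1 (Set.iUnion_subset fun i a ha => (hBP i ha).1)
  have hScard : #S ≤ #ι := by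
    refine mk_insert_le.trans (add_le_of_le hι ?_ (one_le_aleph0.trans hι))
    refine (mk_iUnion_le _).trans ?_
    calc #ι * ⨆ i, #(B i : Set G) ≤ #ι * ℵ₀ := by
          gcongr
          exact ciSup_le' fun i => (lt_aleph0_of_finite _).le
      _ = #ι := mul_aleph0_eq hι
  have : Nonempty S := ⟨⟨1, Set.mem_insert _ _⟩⟩
  obtain ⟨φ⟩ := hScard
  let b : ι → G := fun j => (Function.invFun φ j : S)
  have hbS : ∀ j, b j ∈ S := fun j => (Function.invFun φ j).2
  have hSb : ∀ a ∈ S, ∃ j, b j = a := fun a ha =>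
    ⟨φ ⟨a, ha⟩, congrArg Subtype.val (Function.leftInverse_invFun φ.injective ⟨a, ha⟩)⟩
  have hex : ∃ a, R (fun j => c ((b j)⁻¹ * x)) b a := by
    refine ⟨x, ?_, fun j => rfl⟩
    rintro ⟨j, hj⟩
    exact hx (hj ▸ hSA (hbS j))
  obtain ⟨a, haA, hab, ha⟩ : ∃ a ∈ A, R (fun j => c ((b j)⁻¹ * x)) b a := by
    refine ⟨hex.choose, ?_, hex.choose_spec⟩
    have := hF (fun j => c ((b j)⁻¹ * x)) b fun j => hSA (hbS j)
    simpa only [F, dif_pos hex] using this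
  have hBS : ∀ d ∈ B (c (a⁻¹ * x)), d ∈ S := fun d hd =>
    Set.mem_insert_of_mem _ (Set.mem_iUnion.2 ⟨_, hd⟩)
  obtain ⟨d, hd, hne⟩ := hB (c (a⁻¹ * x)) a ⟨haA, rfl⟩ fun h => hab (hSb a (hBS a h))
  obtain ⟨j, rfl⟩ := hSb d (hBS d hd)
  exact hne ((ha j).trans (hBP _ hd).2)

/-- Adjacent products of consecutive quotients telescope. -/
theorem adjProd_quotients {G : Type u} [Group G] (g : Ordinal.{u} → G) (h : ℕ → G)
    (hg : ∀ n : ℕ, g n = (h n)⁻¹ * h (n + 1)) (m n : ℕ) :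
    adjProd g m n = (h m)⁻¹ * h (m + n + 1) := by
  induction n with
  | zero => exact hg m
  | succ n ih =>
    have : (m : Ordinal.{u}) + ((n : Ordinal) + 1) = ((m + n + 1 : ℕ) : Ordinal) := by
      push_cast
      rw [add_assoc]
    rw [adjProd, ih, this, hg]
    group

/-- For every infinite cardinal `κ`, `(2^κ)⁺ → (ω)_κ^AFP`: every group of cardinality
`(2^κ)⁺` admits, for each colouring in `κ` colours, an injective `ω`-sequence with
monochromatic adjacent finite products. -/
theorem succ_two_pow_arrow_omega_AFP (κ : Cardinal.{u}) (hκ : ℵ₀ ≤ κ)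
    (G : Type u) [Group G] (hG : #G = Order.succ (2 ^ κ)) :
    ArrowAFP G Ordinal.omega0 κ := by
  intro c
  obtain ⟨P, i, hP⟩ := exists_infinite_extensions (by rwa [mk_out])
    (by rw [mk_out, hG]; exact Order.lt_succ _) c
  obtain ⟨h, hQ, hinj⟩ := exists_seq_quotients_mem P _ hP
  let g : Ordinal.{u} → G := fun α => (h (toNat α.card))⁻¹ * h (toNat α.card + 1)
  have hg : ∀ n : ℕ, g n = (h n)⁻¹ * h (n + 1) := fun n => by simp [g]
  refine ⟨g, ?_, i, ?_⟩
  · intro α hα β hβ heq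
    obtain ⟨m, rfl⟩ := Ordinal.lt_omega0.1 hα
    obtain ⟨n, rfl⟩ := Ordinal.lt_omega0.1 hβ
    rw [hg, hg] at heq
    rw [hinj heq]
  · rintro _ ⟨α, hα, n, -, rfl⟩
    obtain ⟨m, rfl⟩ := Ordinal.lt_omega0.1 hα
    rw [adjProd_quotients g h hg]
    exact hQ _ _ (by omega)
end

section
/- Let κ be an infinite cardinal and let G be an arbitrary abelian group with |G| = 2^κ. Then there is a colouring c : G → κ such that for every pair of nonzero elements x, y ∈ G, if c(x) = c(y) then c(x) ≠ c(x + y). -/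
universe u

open Cardinal

/-- Inserting an element disjoint from the supremum preserves independence in a modular lattice. -/
theorem sSupIndep.insert_of_disjoint {α : Type*} [CompleteLattice α] [IsModularLattice α]
    {s : Set α} (hs : sSupIndep s) {a : α} (ha : Disjoint a (sSup s)) :
    sSupIndep (insert a s) := by
  rintro b (rfl | hb)
  · refine ha.mono_right (sSup_le_sSup ?_)
    rintro c ⟨rfl | hc, hne⟩
    · exact absurd rfl hne
    · exact hc
  · have hsub : insert a s \ {b} ⊆ insert a (s \ {b}) := by
      rintro c ⟨rfl | hc, hne⟩
      · exact Or.inl rfl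
      · exact Or.inr ⟨hc, hne⟩
    refine Disjoint.mono_right (sSup_le_sSup hsub) ?_
    rw [sSup_insert, sup_comm]
    refine (hs hb).disjoint_sup_right_of_disjoint_sup_left (ha.symm.mono_left ?_)
    exact sup_le (le_sSup hb) (sSup_le_sSup Set.sdiff_subset)

/-- Every abelian group has an independent family of cyclic subgroups whose join meets every
nonzero cyclic subgroup. -/
theorem exists_sSupIndep_cyclic_essential (G : Type*) [AddCommGroup G] :
    ∃ S : Set (Submodule ℤ G), S ⊆ Set.range (fun g : G => Submodule.span ℤ {g}) ∧
      sSupIndep S ∧ ∀ x : G, Disjoint (Submodule.span ℤ {x}) (sSup S) → x = 0 := by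
  obtain ⟨S, hS⟩ := zorn_subset
    {S : Set (Submodule ℤ G) | S ⊆ Set.range (fun g : G => Submodule.span ℤ {g}) ∧ sSupIndep S}
    (fun C hC hchain => ⟨⋃₀ C, ⟨Set.sUnion_subset fun s hs => (hC hs).1,
      iSupIndep_sUnion_of_directed hchain.directedOn fun s hs => (hC hs).2⟩,
      fun s hs => Set.subset_sUnion_of_mem hs⟩)
  refine ⟨S, hS.prop.1, hS.prop.2, fun x hx => ?_⟩
  have hmem : Submodule.span ℤ {x} ∈ S :=
    hS.le_of_ge ⟨Set.insert_subset ⟨x, rfl⟩ hS.prop.1, hS.prop.2.insert_of_disjoint hx⟩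
      (Set.subset_insert _ _) (Set.mem_insert _ _)
  simpa using hx.eq_bot_of_le (le_sSup hmem)

/-- Every cyclic group embeds in `ℚ × ℚ/ℤ`. -/
theorem exists_injective_span_singleton {G : Type*} [AddCommGroup G] (g : G) :
    ∃ f : Submodule.span ℤ {g} →+ ℚ × AddCircle (1 : ℚ), Function.Injective f := by
  have : Fact ((0 : ℚ) < 1) := ⟨one_pos⟩
  obtain ⟨y, hy⟩ : ∃ y : ℚ × AddCircle (1 : ℚ), addOrderOf y = addOrderOf g := by
    rcases Nat.eq_zero_or_pos (addOrderOf g) with h | h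
    · refine ⟨(1, 0), ?_⟩
      rw [h, Prod.addOrderOf,
        addOrderOf_eq_zero (not_isOfFinAddOrder_of_isAddTorsionFree one_ne_zero)]
      simp
    · refine ⟨(0, ((1 / (addOrderOf g : ℚ) : ℚ) : AddCircle (1 : ℚ))), ?_⟩
      rw [Prod.addOrderOf, AddCircle.addOrderOf_period_div h]
      simp
  have e : AddSubgroup.zmultiples g ≃+ AddSubgroup.zmultiples y :=
    addEquivOfAddCyclicCardEq (by rw [Nat.card_zmultiples, Nat.card_zmultiples, hy])
  have hle : (Submodule.span ℤ {g}).toAddSubgroup = AddSubgroup.zmultiples g := by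
    ext z
    simp [Submodule.mem_span_singleton, AddSubgroup.mem_zmultiples_iff]
  refine ⟨(AddSubgroup.zmultiples y).subtype.comp
    (e.toAddMonoidHom.comp (AddSubgroup.inclusion hle.le)), ?_⟩
  exact Subtype.val_injective.comp (e.injective.comp (AddSubgroup.inclusion_injective hle.le))

/-- A direct sum of divisible groups is divisible. -/
noncomputable instance DFinsupp.divisibleByInt {ι : Type*} {H : ι → Type*}
    [∀ i, AddCommGroup (H i)] [∀ i, DivisibleBy (H i) ℤ] : DivisibleBy (Π₀ i, H i) ℤ :=
  divisibleByOfSMulRightSurj _ _ fun {n} hn f => by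
    classical
    refine ⟨DFinsupp.mk f.support fun i => DivisibleBy.div (f i) n, ?_⟩
    ext i
    by_cases hi : i ∈ f.support
    · simp [DFinsupp.mk_apply, hi, DivisibleBy.div_cancel _ hn]
    · simp [DFinsupp.mk_apply, hi, DFinsupp.notMem_support_iff.1 hi]

/-- Every abelian group embeds in a direct sum of at most `#G` copies of `ℚ × ℚ/ℤ`. -/
theorem exists_embedding_directSum (G : Type u) [AddCommGroup G] :
    ∃ (I : Type u) (f : G →+ Π₀ _ : I, ℚ × AddCircle (1 : ℚ)),
      #I ≤ #G ∧ Function.Injective f := by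
  classical
  obtain ⟨S, hrange, hind, hess⟩ := exists_sSupIndep_cyclic_essential G
  have hemb : ∀ s : S, ∃ f : s.1 →+ ℚ × AddCircle (1 : ℚ), Function.Injective f := by
    rintro ⟨s, hs⟩
    obtain ⟨g, rfl⟩ := hrange hs
    exact exists_injective_span_singleton g
  choose φ hφ using hemb
  let j : (Π₀ s : S, s.1) →+ G :=
    (DFinsupp.lsum ℕ fun s : S => s.1.subtype : (Π₀ s : S, s.1) →ₗ[ℤ] G).toAddMonoidHom
  have hj : Function.Injective j :=
    (sSupIndep_iff S |>.1 hind).dfinsupp_lsum_injective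
  let k : (Π₀ s : S, s.1) →+ Π₀ _ : S, ℚ × AddCircle (1 : ℚ) := DFinsupp.mapRange.addMonoidHom φ
  have hk : Function.Injective k := (DFinsupp.mapRange_injective _ fun s => map_zero (φ s)).2 hφ
  obtain ⟨f, hf⟩ := (Module.Baer.of_divisible _).extension_property_addMonoidHom j hj k
  refine ⟨S, f, (mk_le_mk_of_subset hrange).trans mk_range_le, ?_⟩
  rw [injective_iff_map_eq_zero]
  refine fun x hx => hess x (Submodule.disjoint_def.2 fun z hz hzS => ?_)
  have hfz : f z = 0 := by
    obtain ⟨n, rfl⟩ := Submodule.mem_span_singleton.1 hz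
    rw [map_zsmul, hx, smul_zero]
  rw [sSup_eq_iSup', Submodule.iSup_eq_range_dfinsupp_lsum] at hzS
  obtain ⟨w, rfl⟩ := hzS
  have hw : k w = 0 := by rw [← hf]; exact hfz
  rw [(map_eq_zero_iff k hk).1 hw, map_zero]

open Classical in
/-- The sum of the coordinates of `f` indexed by the `i` such that `e i` agrees with `P` on `F`. -/
noncomputable def patternSum {I K H : Type*} [AddCommGroup H] (e : I → Set K) (F P : Finset K) :
    (Π₀ _ : I, H) →+ H :=
  DFinsupp.sumAddHom fun i => if ∀ k ∈ F, k ∈ e i ↔ k ∈ P then AddMonoidHom.id H else 0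

theorem exists_patternSum_ne_zero {I K H : Type*} [AddCommGroup H] {e : I → Set K}
    (he : Function.Injective e) {f : Π₀ _ : I, H} (hf : f ≠ 0) :
    ∃ F P : Finset K, patternSum e F P f ≠ 0 := by
  classical
  obtain ⟨i, hi⟩ := DFunLike.ne_iff.1 hf
  have hsep : ∀ j, ∃ F : Finset K, j ≠ i → ∃ k ∈ F, ¬(k ∈ e j ↔ k ∈ e i) := by
    intro j
    by_cases hji : j = i
    · exact ⟨∅, fun h => absurd hji h⟩
    · obtain ⟨k, hk⟩ := not_forall.1 fun h => hji (he (Set.ext h))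
      exact ⟨{k}, fun _ => ⟨k, by simp, hk⟩⟩
  choose D hD using hsep
  let F := f.support.biUnion D
  refine ⟨F, F.filter (· ∈ e i), ?_⟩
  rw [patternSum, DFinsupp.sumAddHom_apply, DFinsupp.sum, Finset.sum_eq_single i]
  · rw [if_pos (fun k hk => by simp [hk])]
    exact hi
  · intro j hj hji
    rw [if_neg]
    · rfl
    · intro h
      obtain ⟨k, hk, hne⟩ := hD j hji
      have hkF : k ∈ F := Finset.mem_biUnion.2 ⟨j, hj, hk⟩
      exact hne ((h k hkF).trans (by simp [hkF]))
  · intro h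
    rw [DFinsupp.notMem_support_iff.1 h, map_zero]

/-- For every infinite cardinal `κ` and every abelian group `G` with `|G| = 2^κ`,
there is a colouring `c : G → κ` such that for all nonzero `x, y ∈ G`,
`c(x) = c(y)` implies `c(x) ≠ c(x + y)`. -/
theorem exists_colouring_abelian (κ : Cardinal.{u}) (hκ : ℵ₀ ≤ κ)
    (G : Type u) [AddCommGroup G] (hG : #G = 2 ^ κ) :
    ∃ c : G → κ.out, ∀ x y : G, x ≠ 0 → y ≠ 0 → c x = c y → c x ≠ c (x + y) := by
  obtain ⟨I, f, hI, hf⟩ := exists_embedding_directSum G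
  obtain ⟨e⟩ : Nonempty (I ↪ Set κ.out) := by
    rw [← Cardinal.le_def, mk_set, mk_out, ← hG]
    exact hI
  have : Infinite κ.out := infinite_iff.2 (by rwa [mk_out])
  have : Countable (AddCircle (1 : ℚ)) := Quotient.countable
  obtain ⟨code⟩ : Nonempty
      ((Finset κ.out × Finset κ.out) × ULift.{u} (ℚ × AddCircle (1 : ℚ)) ↪ κ.out) := by
    rw [← Cardinal.le_def, mk_prod, mk_prod, mk_finset_of_infinite]
    simp only [mk_out, lift_id]
    rw [mul_eq_self hκ]
    exact (mul_le_mul_right (mk_le_aleph0.trans hκ) κ).trans (mul_eq_self hκ).le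
  have hsep : ∀ x : G, ∃ q : Finset κ.out × Finset κ.out,
      x ≠ 0 → patternSum e q.1 q.2 (f x) ≠ 0 := by
    intro x
    by_cases hx : x = 0
    · exact ⟨(∅, ∅), fun h => absurd hx h⟩
    · obtain ⟨F, P, h⟩ :=
        exists_patternSum_ne_zero e.injective ((map_ne_zero_iff f hf).2 hx)
      exact ⟨(F, P), fun _ => h⟩
  choose q hq using hsep
  refine ⟨fun x => code (q x, ⟨patternSum e (q x).1 (q x).2 (f x)⟩), ?_⟩
  intro x y hx _ hxy hxxy
  obtain ⟨hqy, hvy⟩ := Prod.ext_iff.1 (code.injective hxy)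
  obtain ⟨hqs, hvs⟩ := Prod.ext_iff.1 (code.injective hxxy)
  simp only [ULift.up_inj] at hqy hvy hqs hvs
  rw [← hqy] at hvy
  rw [← hqs, map_add, map_add, ← hvy] at hvs
  exact hq x hx (left_eq_add.1 hvs)
end

section
/- For every infinite cardinal κ, 2^κ ↛ (ω)_κ^AFP: there exists a group G with |G| = 2^κ and a colouring c : G → κ such that no injective ω-sequence (g_n)_{n<ω} of elements of G has AFP(g_n | n<ω) monochromatic for c. -/
universe u

open Cardinal

/-- A colour of a function into `Multiplicative (ZMod 2)`: a point where it is nontrivial, if any. -/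
noncomputable def supportColour {ι : Type u} [Nonempty ι] (x : ι → Multiplicative (ZMod 2)) : ι :=
  Classical.epsilon fun i => x i ≠ 1

lemma apply_supportColour_ne_one {ι : Type u} [Nonempty ι] {x : ι → Multiplicative (ZMod 2)}
    (hx : x ≠ 1) : x (supportColour x) ≠ 1 :=
  Classical.epsilon_spec (Function.ne_iff.mp hx)

lemma mul_eq_one_of_ne_one : ∀ a b : Multiplicative (ZMod 2), a ≠ 1 → b ≠ 1 → a * b = 1 := by
  decide

/-- Two nontrivial elements sharing their `supportColour` with their product coincide. -/
lemma eq_of_supportColour_eq {ι : Type u} [Nonempty ι] {x y : ι → Multiplicative (ZMod 2)} {i : ι}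
    (hx : x ≠ 1) (hy : y ≠ 1) (hxi : supportColour x = i) (hyi : supportColour y = i)
    (hxyi : supportColour (x * y) = i) : x = y := by
  have hx' := hxi ▸ apply_supportColour_ne_one hx
  have hy' := hyi ▸ apply_supportColour_ne_one hy
  have hxy : x * y = 1 := by
    by_contra h
    exact (hxyi ▸ apply_supportColour_ne_one h) (mul_eq_one_of_ne_one _ _ hx' hy')
  have hsq : ∀ a b : Multiplicative (ZMod 2), a * b = 1 → a = b := by decide
  exact funext fun j => hsq _ _ (congrFun hxy j)

/-- For every infinite cardinal `κ`, `2^κ ↛ (ω)_κ^AFP`: there is a group `G` of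
cardinality `2^κ` with `G ↛ (ω)_κ^AFP`. -/
theorem two_pow_not_arrow_omega_AFP (κ : Cardinal.{u}) (hκ : ℵ₀ ≤ κ) :
    ∃ (G : Type u) (inst : Group G), #G = 2 ^ κ ∧
      ¬ @ArrowAFP G inst Ordinal.omega0 κ := by
  have : Nonempty κ.out :=
    mk_ne_zero_iff.mp (by rw [mk_out]; exact (aleph0_pos.trans_le hκ).ne')
  refine ⟨κ.out → Multiplicative (ZMod 2), inferInstance, ?_, ?_⟩
  · simp
  intro h
  obtain ⟨g, hinj, i, hi⟩ := h supportColour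
  have colour_term (n : ℕ) : supportColour (g n) = i :=
    hi _ ⟨n, Ordinal.natCast_lt_omega0 n, 0, by simp, rfl⟩
  have colour_mul (n : ℕ) : supportColour (g n * g (n + 1 : ℕ)) = i := by
    refine hi _ ⟨n, Ordinal.natCast_lt_omega0 n, 1, ?_, ?_⟩
    · exact_mod_cast Ordinal.natCast_lt_omega0 (n + 1)
    · simp [adjProd]
  have inj {m n : ℕ} (hmn : g m = g n) : m = n := by
    exact_mod_cast hinj m (Ordinal.natCast_lt_omega0 m) n (Ordinal.natCast_lt_omega0 n) hmn
  have one_mem_pair (n : ℕ) : g n = 1 ∨ g (n + 1 : ℕ) = 1 := by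
    by_contra! hn
    have := inj (eq_of_supportColour_eq hn.1 hn.2 (colour_term _) (colour_term _) (colour_mul n))
    omega
  rcases one_mem_pair 0 with h0 | h0 <;> rcases one_mem_pair 2 with h2 | h2 <;>
    exact absurd (inj (h0.trans h2.symm)) (by decide)
end

section
/- Let κ be an infinite cardinal. Then every abelian group G with |G| = 2^κ satisfies G ↛ (ω)_κ^AFS: there exists a colouring c : G → κ such that no injective ω-sequence (g_n)_{n<ω} of elements of G has its set of adjacent finite sums AFS(g_n | n<ω) monochromatic for c. -/
universe u

open Cardinal

/-- The sum `g n + g (n+1) + ⋯ + g (n+m)` of adjacent terms of the `ω`-sequence `g`. -/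
def adjSum {G : Type u} [AddCommGroup G] (g : ℕ → G) (n : ℕ) : ℕ → G
  | 0 => g n
  | m + 1 => adjSum g n m + g (n + (m + 1))

/-- The set of adjacent finite sums of the `ω`-sequence `g`:
`AFS(g_n | n < ω) = { g_n + g_{n+1} + ⋯ + g_{n+m} : n, m < ω }`. -/
def AFS {G : Type u} [AddCommGroup G] (g : ℕ → G) : Set G :=
  { x | ∃ n m : ℕ, x = adjSum g n m }

/-- `G → (ω)_κ^AFS`: for every colouring `c : G → κ` there is an injective `ω`-sequence
of elements of `G` whose set of adjacent finite sums is monochromatic for `c`. -/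
def ArrowAFS (G : Type u) [AddCommGroup G] (κ : Cardinal.{u}) : Prop :=
  ∀ c : G → κ.out, ∃ g : ℕ → G, Function.Injective g ∧ ∃ i : κ.out, ∀ x ∈ AFS g, c x = i

/-- A set `T` of elements of an abelian group is independent when the sum of the cyclic subgroups
generated by its elements is direct. -/
def CyclicIndep {G : Type u} [AddCommGroup G] (T : Set G) : Prop :=
  ∀ a : G →₀ ℤ, (a.support : Set G) ⊆ T → (a.sum fun t n => n • t) = 0 → ∀ t, a t • t = 0

theorem exists_maximal_cyclicIndep (G : Type u) [AddCommGroup G] :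
    ∃ T : Set G, Maximal CyclicIndep T := by
  refine zorn_subset {T : Set G | CyclicIndep T} fun c hc hchain => ?_
  rcases c.eq_empty_or_nonempty with rfl | hne
  · refine ⟨∅, fun a ha _ t => ?_, by simp⟩
    have : a = 0 := by simpa using ha
    simp [this]
  · refine ⟨⋃₀ c, fun a ha hsum t => ?_, fun s hs => Set.subset_sUnion_of_mem hs⟩
    obtain ⟨T, hT, haT⟩ := hchain.directedOn.exists_mem_subset_of_finset_subset_biUnion hne
      (f := id) (s := a.support) (by simpa [Set.sUnion_eq_biUnion] using ha)
    exact hc hT a haT hsum t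

/-- Every nonzero element has a nonzero multiple in the span of a maximal independent set. -/
theorem exists_zsmul_eq_sum_of_maximal {G : Type u} [AddCommGroup G] {T : Set G}
    (hT : Maximal CyclicIndep T) {x : G} (hx : x ≠ 0) :
    ∃ (n : ℤ) (a : G →₀ ℤ), (a.support : Set G) ⊆ T ∧ (a.sum fun t m => m • t) = n • x ∧
      ∃ t, a t • t ≠ 0 := by
  classical
  by_cases hxT : x ∈ T
  · refine ⟨1, Finsupp.single x 1, ?_, by simp, x, by simpa using hx⟩
    refine (Finset.coe_subset.2 Finsupp.support_single_subset).trans (by simpa using hxT)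
  · have hnot : ¬ CyclicIndep (insert x T) := fun h =>
      hxT (hT.le_of_ge h (Set.subset_insert x T) (Set.mem_insert x T))
    simp only [CyclicIndep, not_forall] at hnot
    obtain ⟨a, ha, hsum, t, ht⟩ := hnot
    have hsupp : ((a.erase x).support : Set G) ⊆ T := by
      intro y hy
      have hy' : a y ≠ 0 ∧ y ≠ x := by simpa [Finsupp.support_erase] using hy
      exact (ha (by simpa using hy'.1)).resolve_left hy'.2
    have hsplit : a x • x + ((a.erase x).sum fun t m => m • t) = 0 := by
      rw [← hsum]
      by_cases hxa : x ∈ a.support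
      · exact Finsupp.add_sum_erase a x (fun t m => m • t) hxa
      · rw [Finsupp.erase_of_notMem_support hxa, Finsupp.notMem_support_iff.1 hxa]
        simp
    refine ⟨-a x, a.erase x, hsupp, ?_, ?_⟩
    · rw [neg_smul]
      exact eq_neg_of_add_eq_zero_right hsplit
    · by_contra! hall
      have hzero : ((a.erase x).sum fun t m => m • t) = 0 :=
        Finset.sum_eq_zero fun t _ => hall t
      rw [hzero, add_zero] at hsplit
      by_cases htx : t = x
      · exact ht (htx ▸ hsplit)
      · exact ht (by simpa [Finsupp.erase_ne htx] using hall t)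

/-- Values on an independent set which respect the orders of its elements extend to a character. -/
theorem CyclicIndep.exists_character {G : Type u} [AddCommGroup G] {T : Set G}
    (hT : CyclicIndep T) (v : G → AddCircle (1 : ℚ)) (hv : ∀ t, addOrderOf t • v t = 0) :
    ∃ φ : G →ₗ[ℤ] AddCircle (1 : ℚ), ∀ t ∈ T, φ t = v t := by
  let L : Finsupp.supported ℤ ℤ T →ₗ[ℤ] G :=
    (Finsupp.linearCombination ℤ (id : G → G)).comp (Submodule.subtype _)
  let Ψ : Finsupp.supported ℤ ℤ T →ₗ[ℤ] AddCircle (1 : ℚ) :=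
    (Finsupp.linearCombination ℤ v).comp (Submodule.subtype _)
  have hker : LinearMap.ker L ≤ LinearMap.ker Ψ := by
    rintro ⟨a, ha⟩ hL
    have hL' := hT a ha hL
    refine Finset.sum_eq_zero fun t _ => ?_
    obtain ⟨k, hk⟩ := addOrderOf_dvd_iff_zsmul_eq_zero.2 (hL' t)
    change a t • v t = 0
    rw [hk, mul_comm, mul_smul, natCast_zsmul, hv, smul_zero]
  obtain ⟨φ, hφ⟩ := (Module.Baer.of_divisible (AddCircle (1 : ℚ))).extension_property
    ((LinearMap.ker L).liftQ L le_rfl)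
    (LinearMap.ker_eq_bot.1 (Submodule.ker_liftQ_eq_bot' _ _ rfl))
    ((LinearMap.ker L).liftQ Ψ hker)
  refine ⟨φ, fun t ht => ?_⟩
  have := LinearMap.congr_fun hφ
    (Submodule.Quotient.mk ⟨Finsupp.single t 1, Finsupp.single_mem_supported ℤ 1 ht⟩)
  simpa [L, Ψ] using this

/-- An element of `ℚ/ℤ` of the same order as `t` if `t` is torsion, and of order `m + 1`
otherwise. -/
noncomputable def torsionValue {G : Type u} [AddCommGroup G] (m : ℕ) (t : G) : AddCircle (1 : ℚ) :=
  if addOrderOf t = 0 then (((1 : ℚ) / ((m + 1 : ℕ) : ℚ) : ℚ) : AddCircle (1 : ℚ))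
  else (((1 : ℚ) / (addOrderOf t : ℚ) : ℚ) : AddCircle (1 : ℚ))

theorem addOrderOf_nsmul_torsionValue {G : Type u} [AddCommGroup G] (m : ℕ) (t : G) :
    addOrderOf t • torsionValue m t = 0 := by
  unfold torsionValue
  split_ifs with h
  · simp [h]
  · rw [← addOrderOf_dvd_iff_nsmul_eq_zero, AddCircle.addOrderOf_period_div (Nat.pos_of_ne_zero h)]

theorem zsmul_torsionValue_ne_zero {G : Type u} [AddCommGroup G] {a : ℤ} {t : G}
    (h : a • t ≠ 0) : a • torsionValue a.natAbs t ≠ 0 := by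
  unfold torsionValue
  split_ifs with h0
  · rw [Ne, ← addOrderOf_dvd_iff_zsmul_eq_zero, AddCircle.addOrderOf_period_div (Nat.succ_pos _)]
    intro hdvd
    have ha : a ≠ 0 := by
      rintro rfl
      simp at h
    have := Nat.le_of_dvd (Int.natAbs_pos.2 ha) (Int.natCast_dvd.1 hdvd)
    omega
  · rwa [Ne, ← addOrderOf_dvd_iff_zsmul_eq_zero,
      AddCircle.addOrderOf_period_div (Nat.pos_of_ne_zero h0), addOrderOf_dvd_iff_zsmul_eq_zero]

/-- Finitely many points of `K → Bool` can be told apart from another one by a basic clopen set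
coded by two finite subsets of `K`. -/
theorem exists_finset_separating {K α : Type u} [DecidableEq K] {e : α → K → Bool}
    (he : Function.Injective e) (S : Finset α) (x : α) :
    ∃ F P : Finset K, (∀ k ∈ F, e x k = decide (k ∈ P)) ∧
      ∀ y ∈ S, (∀ k ∈ F, e y k = decide (k ∈ P)) → y = x := by
  classical
  have hsep : ∀ y, ∃ F : Finset K, (∀ k ∈ F, e y k = e x k) → y = x := by
    intro y
    by_cases hyx : y = x
    · exact ⟨∅, fun _ => hyx⟩
    · obtain ⟨k, hk⟩ := Function.ne_iff.1 (he.ne hyx)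
      exact ⟨{k}, fun h => absurd (h k (by simp)) hk⟩
  choose F hF using hsep
  have hP : ∀ k ∈ S.biUnion F, e x k = decide (k ∈ (S.biUnion F).filter fun k => e x k = true) := by
    intro k hk
    simp only [Finset.mem_filter, hk, true_and, Bool.decide_eq_true]
  refine ⟨S.biUnion F, _, hP, fun y hy h => hF y fun k hk => ?_⟩
  have hk' := Finset.mem_biUnion.2 ⟨y, hy, hk⟩
  rw [h k hk', hP k hk']

/-- If `G` has at most `2 ^ #K` elements, then a family of characters indexed by finite data
over `K` separates the points of `G`. -/
theorem exists_separating_characters {G K : Type u} [AddCommGroup G] {e : G → K → Bool}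
    (he : Function.Injective e) :
    ∃ φ : Finset K × Finset K × ℕ → G →ₗ[ℤ] AddCircle (1 : ℚ), ∀ x ≠ 0, ∃ i, φ i x ≠ 0 := by
  classical
  obtain ⟨T, hT⟩ := exists_maximal_cyclicIndep G
  let v : Finset K × Finset K × ℕ → G → AddCircle (1 : ℚ) := fun i t =>
    if ∀ k ∈ i.1, e t k = decide (k ∈ i.2.1) then torsionValue i.2.2 t else 0
  have hv : ∀ i t, addOrderOf t • v i t = 0 := by
    intro i t
    dsimp only [v]
    split_ifs
    · exact addOrderOf_nsmul_torsionValue _ t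
    · exact smul_zero _
  choose φ hφ using fun i => hT.prop.exists_character (v i) (hv i)
  refine ⟨φ, fun x hx => ?_⟩
  obtain ⟨n, a, ha, hsum, t, ht⟩ := exists_zsmul_eq_sum_of_maximal hT hx
  obtain ⟨F, P, hFP, hsep⟩ := exists_finset_separating he a.support t
  refine ⟨(F, P, (a t).natAbs), fun hzero => zsmul_torsionValue_ne_zero ht ?_⟩
  have hmap := congrArg (φ (F, P, (a t).natAbs)) hsum
  rw [map_zsmul, hzero, smul_zero, Finsupp.sum, map_sum, Finset.sum_eq_single t] at hmap
  · have htT : t ∈ T := ha (by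
      rw [Finset.mem_coe, Finsupp.mem_support_iff]
      rintro h
      simp [h] at ht)
    rw [map_zsmul, hφ _ t htT] at hmap
    simpa only [v, if_pos hFP] using hmap
  · intro y hy hyt
    rw [map_zsmul, hφ _ y (ha hy)]
    simp only [v]
    rw [if_neg fun h => hyt (hsep y hy h), smul_zero]
  · intro hnot
    rw [Finsupp.notMem_support_iff.1 hnot, zero_smul, map_zero]

theorem exists_injective_colours (K : Type u) [Infinite K] :
    ∃ j : Option ((Finset K × Finset K × ℕ) × AddCircle (1 : ℚ)) → K, Function.Injective j := by
  have hK : ℵ₀ ≤ #K := Cardinal.aleph0_le_mk K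
  have : Countable (AddCircle (1 : ℚ)) := Quotient.countable
  have hH : Cardinal.lift.{u} #(AddCircle (1 : ℚ)) ≤ #K :=
    (Cardinal.lift_le_aleph0.2 Cardinal.mk_le_aleph0).trans hK
  have hle : #(Option ((Finset K × Finset K × ℕ) × AddCircle (1 : ℚ))) ≤ #K := by
    simp only [Cardinal.mk_option, Cardinal.mk_prod, Cardinal.mk_finset_of_infinite,
      Cardinal.lift_id, Cardinal.lift_uzero, Cardinal.mk_nat, Cardinal.lift_aleph0]
    refine Cardinal.add_le_of_le hK ?_ (Cardinal.one_le_aleph0.trans hK)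
    exact Cardinal.mul_le_of_le hK
      (Cardinal.mul_le_of_le hK le_rfl (Cardinal.mul_le_of_le hK le_rfl hK)) hH
  obtain ⟨j⟩ := hle
  exact ⟨j, j.injective⟩

/-- For every infinite cardinal `κ`, every abelian group `G` with `|G| = 2^κ`
satisfies `G ↛ (ω)_κ^AFS`. -/
theorem abelian_not_arrow_omega_AFS (κ : Cardinal.{u}) (hκ : ℵ₀ ≤ κ)
    (G : Type u) [AddCommGroup G] (hG : #G = 2 ^ κ) : ¬ ArrowAFS G κ := by
  classical
  have : Infinite κ.out := by rwa [Cardinal.infinite_iff, Cardinal.mk_out]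
  have hcard : #G = #(κ.out → ULift.{u} Bool) := by simp [hG]
  obtain ⟨e⟩ := Cardinal.eq.1 hcard
  have he : Function.Injective fun (x : G) (k : κ.out) => (e x k).down := fun x y h =>
    e.injective (funext fun k => ULift.down_injective (congrFun h k))
  obtain ⟨φ, hφ⟩ := exists_separating_characters he
  obtain ⟨j, hj⟩ := exists_injective_colours κ.out
  choose i hi using hφ
  intro harrow
  obtain ⟨g, hg, colour, hcolour⟩ := harrow fun x =>
    j (if hx : x = 0 then none else some (i x hx, φ (i x hx) x))
  have h0 := hcolour (g 0) ⟨0, 0, rfl⟩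
  have h1 := hj ((hcolour (g 1) ⟨1, 0, rfl⟩).trans h0.symm)
  have h01 := hj ((hcolour (g 0 + g 1) ⟨0, 1, rfl⟩).trans h0.symm)
  by_cases hg0 : g 0 = 0
  · have hg1 : g 1 = 0 := by
      by_contra hne
      simp [hg0, hne] at h1
    exact absurd (hg (hg0.trans hg1.symm)) (by simp)
  · have hg1 : g 1 ≠ 0 := by
      intro h
      simp [hg0, h] at h1
    have hg01 : g 0 + g 1 ≠ 0 := by
      intro h
      simp [hg0, h] at h01
    simp only [dif_neg hg0, dif_neg hg1, dif_neg hg01, Option.some.injEq, Prod.mk.injEq] at h1 h01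
    obtain ⟨hi1, hv1⟩ := h1
    obtain ⟨hi01, hv01⟩ := h01
    rw [hi1] at hv1
    rw [hi01, map_add, hv1] at hv01
    exact hi (g 0) hg0 (add_eq_left.1 hv01)
end

section
/- For every infinite cardinal κ there exists a non-abelian group G with |G| = 2^κ and a colouring c : G → κ such that for all non-identity elements x, y ∈ G, if c(x) = c(y) then c(x) ≠ c(x · y). -/
universe u

open Cardinal

/-- In a power of a group, colour `x` by a coordinate `i` in its support together with `x i`:
two non-identity elements of the same colour have a product of a different colour. -/
theorem exists_pi_colouring (ι : Type*) [Nonempty ι] (H : Type*) [Group H] :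
    ∃ c : (ι → H) → ι × H, ∀ x y : ι → H, x ≠ 1 → c x = c y → c x ≠ c (x * y) := by
  have support (x : ι → H) : ∃ i, x ≠ 1 → x i ≠ 1 := by
    by_cases hx : x = 1
    · exact ⟨Classical.arbitrary ι, fun h => absurd hx h⟩
    · obtain ⟨i, hi⟩ := Function.ne_iff.mp hx
      exact ⟨i, fun _ => hi⟩
  choose f hf using support
  refine ⟨fun x => (f x, x (f x)), fun x y hx hxy hxz => hf x hx ?_⟩
  obtain ⟨hy, hxy⟩ := Prod.ext_iff.mp hxy
  obtain ⟨hz, hxz⟩ := Prod.ext_iff.mp hxz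
  dsimp only at hy hxy hz hxz
  rw [← hz, Pi.mul_apply] at hxz
  rw [← hy] at hxy
  rw [← hxy] at hxz
  exact left_eq_mul.mp hxz

/-- For every infinite cardinal `κ` there is a non-abelian group `G` with `|G| = 2^κ`
and a colouring `c : G → κ` such that for all non-identity `x, y ∈ G`,
`c(x) = c(y)` implies `c(x) ≠ c(x · y)`. -/
theorem exists_nonabelian_colouring (κ : Cardinal.{u}) (hκ : ℵ₀ ≤ κ) :
    ∃ (G : Type u) (inst : Group G), (¬ ∀ x y : G, x * y = y * x) ∧ #G = 2 ^ κ ∧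
      ∃ c : G → κ.out, ∀ x y : G, x ≠ 1 → y ≠ 1 → c x = c y → c x ≠ c (x * y) := by
  have : Infinite κ.out := by rwa [infinite_iff, mk_out]
  refine ⟨κ.out → Equiv.Perm (Fin 3), inferInstance, fun h => ?_, ?_, ?_⟩
  · have noncomm : (Equiv.swap 0 1 : Equiv.Perm (Fin 3)) * Equiv.swap 1 2 ≠
        Equiv.swap 1 2 * Equiv.swap 0 1 := by decide
    exact noncomm (congrFun (h (fun _ => Equiv.swap 0 1) (fun _ => Equiv.swap 1 2))
      (Classical.arbitrary κ.out))
  · have card : #(Equiv.Perm (Fin 3)) = (6 : ℕ) := by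
      rw [mk_fintype, Fintype.card_perm, Fintype.card_fin]
      rfl
    rw [mk_pi, prod_const, mk_out, card, lift_natCast, lift_uzero]
    exact nat_power_eq hκ (by norm_num)
  · obtain ⟨c, hc⟩ := exists_pi_colouring κ.out (Equiv.Perm (Fin 3))
    have card_le : #(κ.out × Equiv.Perm (Fin 3)) ≤ #κ.out := by
      rw [mk_prod, lift_uzero, mk_out]
      exact mul_le_of_le hκ le_rfl ((lift_lt_aleph0.mpr (lt_aleph0_of_finite _)).le.trans hκ)
    obtain ⟨e⟩ := card_le
    exact ⟨e ∘ c, fun x y hx _ hxy hxz => hc x y hx (e.injective hxy) (e.injective hxz)⟩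
end
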